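/- arXiv:1503.07323 — 4 statements merged into one kernel-verified Lean document; each statement's English description precedes it below -/
import Mathlib

section
/- Let (H, q) be a polarized rational Hodge structure of weight 2 such that dim_ℂ H^{2,0} = 1 and such that the only Hodge class of H is 0. Then H is simple: every sub-Hodge structure of H is either 0 or all of H. -/
/- STATEMENT 1: A polarized rational Hodge structure (H, q) of weight 2 with
dim_ℂ H^{2,0} = 1 whose only Hodge class is 0 is simple: every sub-Hodge structure
is 0 or H. -/

open TensorProduct ComplexOrder

/-- Complex conjugation on `ℂ ⊗[ℚ] H`, acting on the `ℂ` factor. -/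
noncomputable def conjC (H : Type*) [AddCommGroup H] [Module ℚ H] :
    ℂ ⊗[ℚ] H →ₗ[ℚ] ℂ ⊗[ℚ] H :=
  LinearMap.rTensor H ((Complex.conjAe.toLinearMap : ℂ →ₗ[ℝ] ℂ).restrictScalars ℚ)

/-- `W ⊆ H` is a sub-Hodge structure: `W_ℂ` is the sum of its intersections with the
Hodge components. -/
def IsSubHS2 {H : Type*} [AddCommGroup H] [Module ℚ H]
    (H20 H11 H02 : Submodule ℂ (ℂ ⊗[ℚ] H)) (W : Submodule ℚ H) : Prop :=
  W.baseChange ℂ = (W.baseChange ℂ ⊓ H20) ⊔ (W.baseChange ℂ ⊓ H11) ⊔ (W.baseChange ℂ ⊓ H02)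

lemma conjC_conjC {H : Type*} [AddCommGroup H] [Module ℚ H] (x : ℂ ⊗[ℚ] H) :
    conjC H (conjC H x) = x := by
  induction x using TensorProduct.induction_on with
  | zero => simp
  | tmul z h => simp [conjC]
  | add x y hx hy => rw [map_add, map_add, hx, hy]

lemma conjC_mem_baseChange {H : Type*} [AddCommGroup H] [Module ℚ H] {W : Submodule ℚ H}
    {x : ℂ ⊗[ℚ] H} (hx : x ∈ W.baseChange ℂ) : conjC H x ∈ W.baseChange ℂ := by
  obtain ⟨t, rfl⟩ := hx
  induction t using TensorProduct.induction_on with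
  | zero => simp
  | tmul z w =>
    simpa [conjC] using Submodule.tmul_mem_baseChange_of_mem (starRingEnd ℂ z) w.2
  | add x y hx hy =>
    rw [map_add, map_add]
    exact add_mem hx hy

lemma baseChange_apply_eq_zero_of_mem_orthogonal {H : Type*} [AddCommGroup H] [Module ℚ H]
    {q : LinearMap.BilinForm ℚ H} (hq : q.IsSymm) {W : Submodule ℚ H} {h : H}
    (hh : h ∈ q.orthogonal W) {y : ℂ ⊗[ℚ] H} (hy : y ∈ W.baseChange ℂ) :
    q.baseChange ℂ (1 ⊗ₜ[ℚ] h) y = 0 := by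
  obtain ⟨t, rfl⟩ := hy
  induction t using TensorProduct.induction_on with
  | zero => simp
  | tmul z w =>
    have hw : q h w = 0 := by
      rw [← hq.eq w h]
      exact hh w w.2
    simp [hw]
  | add x y hx hy => rw [map_add, map_add, hx, hy, add_zero]

theorem statement1
    -- H is a finite-dimensional ℚ-vector space
    (H : Type*) [AddCommGroup H] [Module ℚ H] [FiniteDimensional ℚ H]
    -- Hodge decomposition of H_ℂ := ℂ ⊗[ℚ] H into complex subspaces
    (H20 H11 H02 : Submodule ℂ (ℂ ⊗[ℚ] H))
    (hdec : DirectSum.IsInternal (![H20, H11, H02] : Fin 3 → Submodule ℂ (ℂ ⊗[ℚ] H)))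
    -- complex conjugation maps H^{2,0} onto H^{0,2} and H^{1,1} onto itself
    (hconj20 : (H20.restrictScalars ℚ).map (conjC H) = H02.restrictScalars ℚ)
    (hconj11 : (H11.restrictScalars ℚ).map (conjC H) = H11.restrictScalars ℚ)
    -- q is a symmetric ℚ-bilinear form on H
    (q : LinearMap.BilinForm ℚ H)
    (hsymm : ∀ x y, q x y = q y x)
    -- first Hodge-Riemann relation: q_ℂ(H^{p,q}, H^{p',q'}) = 0 unless (p',q') = (2-p,2-q)
    (horth : ∀ x y : ℂ ⊗[ℚ] H,
      ((x ∈ H20 ∧ (y ∈ H20 ∨ y ∈ H11)) ∨ (x ∈ H11 ∧ (y ∈ H20 ∨ y ∈ H02)) ∨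
        (x ∈ H02 ∧ (y ∈ H02 ∨ y ∈ H11))) → q.baseChange ℂ x y = 0)
    -- second Hodge-Riemann relations
    (hpos20 : ∀ v ∈ H20, v ≠ 0 → 0 < q.baseChange ℂ v (conjC H v))
    (hpos02 : ∀ v ∈ H02, v ≠ 0 → 0 < q.baseChange ℂ v (conjC H v))
    (hneg11 : ∀ v ∈ H11, v ≠ 0 → q.baseChange ℂ v (conjC H v) < 0)
    -- dim_ℂ H^{2,0} = 1
    (h20dim : Module.finrank ℂ H20 = 1)
    -- the only Hodge class of H is 0
    (hhodge : ∀ h : H, ((1 : ℂ) ⊗ₜ[ℚ] h : ℂ ⊗[ℚ] H) ∈ H11 → h = 0) :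
    -- H is simple
    ∀ W : Submodule ℚ H, IsSubHS2 H20 H11 H02 W → W = ⊥ ∨ W = ⊤ := by
  intro W hW
  have conj20 : ∀ x ∈ H20, conjC H x ∈ H02 := fun x hx => by
    have : conjC H x ∈ (H20.restrictScalars ℚ).map (conjC H) := ⟨x, hx, rfl⟩
    rwa [hconj20] at this
  have conj02 : ∀ x ∈ H02, conjC H x ∈ H20 := fun x hx => by
    have hx' : x ∈ (H20.restrictScalars ℚ).map (conjC H) := by rwa [hconj20]
    obtain ⟨y, hy, rfl⟩ := hx'
    rwa [conjC_conjC]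
  have hatom : IsAtom H20 := Submodule.isAtom_iff_finrank_eq_one.mpr h20dim
  rcases (em (H20 ≤ W.baseChange ℂ)).imp_right hatom.not_le_iff_disjoint.mp with h20 | h20
  · right
    have h02 : H02 ≤ W.baseChange ℂ := fun x hx => by
      simpa [conjC_conjC] using conjC_mem_baseChange (h20 (conj02 x hx))
    have hq : q.IsSymm := ⟨hsymm⟩
    have horthW : q.orthogonal W = ⊥ := by
      refine (Submodule.eq_bot_iff _).mpr fun h hh => hhodge h ?_
      have hsup : H20 ⊔ H11 ⊔ H02 = ⊤ := by
        simpa [iSup_fin_three] using hdec.submodule_iSup_eq_top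
      have hmem : (1 : ℂ) ⊗ₜ[ℚ] h ∈ H20 ⊔ H11 ⊔ H02 := hsup ▸ Submodule.mem_top
      obtain ⟨_, hab, c, hc, habc⟩ := Submodule.mem_sup.mp hmem
      obtain ⟨a, ha, b, hb, rfl⟩ := Submodule.mem_sup.mp hab
      have ha0 : a = 0 := by
        by_contra hne
        have hzero := baseChange_apply_eq_zero_of_mem_orthogonal hq hh (h02 (conj20 a ha))
        rw [← habc, map_add, map_add, LinearMap.add_apply, LinearMap.add_apply,
          horth b _ (.inr (.inl ⟨hb, .inr (conj20 a ha)⟩)),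
          horth c _ (.inr (.inr ⟨hc, .inl (conj20 a ha)⟩)), add_zero, add_zero] at hzero
        exact (hpos20 a ha hne).ne' hzero
      have hc0 : c = 0 := by
        by_contra hne
        have hzero := baseChange_apply_eq_zero_of_mem_orthogonal hq hh (h20 (conj02 c hc))
        rw [← habc, map_add, map_add, LinearMap.add_apply, LinearMap.add_apply,
          horth a _ (.inl ⟨ha, .inl (conj02 c hc)⟩),
          horth b _ (.inr (.inl ⟨hb, .inl (conj02 c hc)⟩)), zero_add, zero_add] at hzero
        exact (hpos02 c hc hne).ne' hzero
      rwa [← habc, ha0, hc0, zero_add, add_zero]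
    have hdim := LinearMap.BilinForm.finrank_add_finrank_orthogonal' (B := q) W
    rw [horthW, finrank_bot] at hdim
    exact Submodule.eq_top_of_finrank_eq (le_antisymm W.finrank_le (by lia))
  · left
    have h02 : Disjoint (W.baseChange ℂ) H02 := by
      refine Submodule.disjoint_def.mpr fun x hxW hx => ?_
      rw [← conjC_conjC x, Submodule.disjoint_def.mp h20 _ (conj02 x hx)
        (conjC_mem_baseChange hxW), map_zero]
    have hle : W.baseChange ℂ ≤ H11 := by
      rw [hW, h20.symm.eq_bot, h02.eq_bot, bot_sup_eq, sup_bot_eq]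
      exact inf_le_right
    exact (Submodule.eq_bot_iff W).mpr fun w hw =>
      hhodge w (hle (Submodule.tmul_mem_baseChange_of_mem 1 hw))
end

section
/- Let V and W be complex vector spaces, let p be a positive integer, let u ∈ End_ℂ(V) satisfy u^p = id_V, let w ∈ End_ℂ(W), and let λ ∈ ℂ be nonzero. Let S ⊆ V be a u-invariant subspace such that u has no eigenvector in S with eigenvalue λ^{-1}, and let T ⊆ W be a subspace with w t = λ t for all t ∈ T. Then the only element of the image of S ⊗_ℂ T in V ⊗_ℂ W that is fixed by u ⊗ w is 0. -/
/- STATEMENT 4: Let u be an endomorphism of a complex vector space V with u^p = id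
(p > 0), w an endomorphism of W, and λ ≠ 0. If S ⊆ V is u-invariant with no
eigenvector of eigenvalue λ⁻¹, and T ⊆ W satisfies w t = λ t on T, then the only
element of the image of S ⊗ T in V ⊗ W fixed by u ⊗ w is 0. -/

open TensorProduct

/-- The image of `S ⊗ T` in `V ⊗[ℂ] W` under the canonical map. -/
noncomputable def tensorImage {V W : Type*} [AddCommGroup V] [Module ℂ V]
    [AddCommGroup W] [Module ℂ W] (S : Submodule ℂ V) (T : Submodule ℂ W) :
    Submodule ℂ (V ⊗[ℂ] W) :=
  LinearMap.range (TensorProduct.mapIncl S T)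

theorem statement4
    (V W : Type*) [AddCommGroup V] [Module ℂ V] [AddCommGroup W] [Module ℂ W]
    (p : ℕ) (hp : 0 < p)
    (u : Module.End ℂ V) (hu : u ^ p = 1)
    (w : Module.End ℂ W)
    (lam : ℂ) (hlam : lam ≠ 0)
    (S : Submodule ℂ V)
    -- S is u-invariant
    (hSinv : ∀ s ∈ S, u s ∈ S)
    -- u has no eigenvector in S with eigenvalue λ⁻¹
    (hSeig : ∀ s ∈ S, u s = lam⁻¹ • s → s = 0)
    (T : Submodule ℂ W)
    -- w t = λ t for all t ∈ T
    (hT : ∀ t ∈ T, w t = lam • t) :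
    -- the only element of the image of S ⊗ T fixed by u ⊗ w is 0
    ∀ x ∈ tensorImage S T, TensorProduct.map u w x = x → x = 0 := by
  rintro _ ⟨y, rfl⟩ hfix
  let f : S →ₗ[ℂ] S := u.restrict hSinv - lam⁻¹ • LinearMap.id
  have hf : Function.Injective f := by
    rw [injective_iff_map_eq_zero]
    intro s hs
    have hus := congrArg S.subtype hs
    exact Subtype.ext (hSeig s s.2 (sub_eq_zero.mp (by simpa [f] using hus)))
  have hf_tensor : Function.Injective (f.rTensor T) :=
    Module.Flat.rTensor_preserves_injective_linearMap f hf
  have hincl : Function.Injective (mapIncl S T) :=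
    Module.Flat.tensorProduct_mapIncl_injective_of_right S T
  have hcomm : lam • (mapIncl S T ∘ₗ f.rTensor T) =
      TensorProduct.map u w ∘ₗ mapIncl S T - mapIncl S T := by
    ext s t
    simp [f, mapIncl, hT t t.2, smul_sub, smul_tmul', smul_smul, hlam]
  have hzero : lam • mapIncl S T (f.rTensor T y) = 0 := by
    simpa [hfix] using LinearMap.congr_fun hcomm y
  have hy : y = 0 := by
    apply hf_tensor
    apply hincl
    simpa [hlam] using hzero
  simp [hy]
end

section
/- Let (H, H^{2,0}, H^{1,1}, H^{0,2}) be a rational Hodge structure of weight 2 with H^{2,0} ≠ 0, carrying an automorphism ψ with ψ^p = id for a positive integer p, such that ψ_ℂ acts on H^{2,0} as multiplication by a scalar λ with λ ≠ 1. Let (H₁, H₁^{1,0}, H₁^{0,1}) be a rational Hodge structure of weight 1 carrying an automorphism ψ' with (ψ')^p = id, such that λ^{-1} is not an eigenvalue of ψ'_ℂ on H₁^{1,0} but λ^{-1} is an eigenvalue of ψ'_ℂ on H₁^{0,1}. Let H₂ := {x ∈ H₁ ⊗_ℚ H : (ψ' ⊗ ψ)(x) = x}, and let c : H₁^∨ ⊗_ℚ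 H₂ → H be the contraction map defined by c(u ⊗ x) = (u ⊗ id_H)(x), where H₁^∨ is the ℚ-linear dual of H₁ and H₂ is viewed inside H₁ ⊗_ℚ H. Then the image of c is a nonzero sub-Hodge structure of H; in particular, if H has no sub-Hodge structures other than 0 and H, then c is surjective. -/
/- STATEMENT 6: In the setting of Statement 5, the contraction map
c : H₁^∨ ⊗ H₂ → H, c(u ⊗ x) = (u ⊗ id_H)(x), has nonzero image which is a sub-Hodge
structure of H; in particular, if H is simple then c is surjective. -/

open TensorProduct

/-- The projections attached to an internal direct sum decomposition commute with every
endomorphism preserving the summands. -/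
theorem exists_projections_of_isInternal {ι R M : Type*} [Fintype ι] [DecidableEq ι] [Ring R]
    [AddCommGroup M] [Module R M] (A : ι → Submodule R M) (hA : DirectSum.IsInternal A) :
    ∃ φ : ι → Module.End R M, (∀ j v, φ j v ∈ A j) ∧ (∀ v, ∑ j, φ j v = v) ∧
      ∀ T : Module.End R M, (∀ i, ∀ v ∈ A i, T v ∈ A i) → ∀ j v, φ j (T v) = T (φ j v) := by
  let := hA.chooseDecomposition
  let φ : ι → Module.End R M := fun j =>
    (A j).subtype ∘ₗ DirectSum.component R ι (fun i => A i) j ∘ₗ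
      (DirectSum.decomposeLinearEquiv A).toLinearMap
  have hφ : ∀ j v, φ j v = (DirectSum.decompose A v j : M) := fun _ _ => rfl
  have hsum : ∀ v, ∑ j, φ j v = v := fun v => by
    simp only [hφ]
    classical
    refine Eq.trans ?_ (DirectSum.sum_support_decompose A v)
    exact (Finset.sum_subset (Finset.subset_univ _) fun i _ hi => by simpa using hi).symm
  have hmem : ∀ j v, φ j v ∈ A j := fun j v => (DirectSum.decompose A v j).2
  have hself : ∀ i j, ∀ v ∈ A i, φ j v = if i = j then v else 0 := fun i j v hv => by
    rw [hφ]
    split_ifs with h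
    · subst h
      exact DirectSum.decompose_of_mem_same A hv
    · exact DirectSum.decompose_of_mem_ne A hv h
  refine ⟨φ, hmem, hsum, fun T hT j v => ?_⟩
  conv_lhs => rw [← hsum v]
  rw [map_sum, map_sum, Finset.sum_congr rfl fun i _ => hself i j _ (hT i _ (hmem i v))]
  simp

/-- A tensor all of whose contractions against linear forms on the left factor lie in `W`
comes from `A ⊗ W`. -/
theorem mem_range_lTensor_subtype_of_contractions {k A M : Type*} [Field k] [AddCommGroup A]
    [Module k A] [AddCommGroup M] [Module k M] (W : Submodule k M) (x : A ⊗[k] M)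
    (hx : ∀ l : Module.Dual k A, TensorProduct.lid k M (LinearMap.rTensor M l x) ∈ W) :
    x ∈ LinearMap.range (LinearMap.lTensor A W.subtype) := by
  classical
  let b := Module.Basis.ofVectorSpace k A
  obtain ⟨f, rfl⟩ := (TensorProduct.equivFinsuppOfBasisLeft b).symm.surjective x
  rw [TensorProduct.equivFinsuppOfBasisLeft_symm_apply] at hx ⊢
  refine Submodule.sum_mem _ fun i hi => ?_
  have h := hx (b.coord i)
  have hfi : f i ∈ W := by
    have hfi0 : f i ≠ 0 := Finsupp.mem_support_iff.mp hi
    simpa [Finsupp.sum, map_sum, Finsupp.single_apply, ite_smul, hfi0] using h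
  exact ⟨b i ⊗ₜ ⟨f i, hfi⟩, by simp⟩

/-- The scalar extension of `W` consists of the tensors whose coordinates lie in `W`. -/
theorem mem_baseChange_of_contractions {k K M : Type*} [Field k] [Field K] [Algebra k K]
    [AddCommGroup M] [Module k M] (W : Submodule k M) (x : K ⊗[k] M)
    (hx : ∀ l : Module.Dual k K, TensorProduct.lid k M (LinearMap.rTensor M l x) ∈ W) :
    x ∈ W.baseChange K := by
  obtain ⟨y, rfl⟩ := mem_range_lTensor_subtype_of_contractions W x hx
  clear hx
  induction y with
  | zero => simp
  | tmul a w => exact Submodule.tmul_mem_baseChange_of_mem a w.2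
  | add y z hy hz =>
    rw [map_add]
    exact add_mem hy hz

/-- A subspace stable under all `k`-endomorphisms commuting with `ψ` has a scalar extension stable
under all `K`-endomorphisms commuting with the extension of `ψ`. -/
theorem baseChange_stable_of_commuting {k K M : Type*} [Field k] [Field K] [Algebra k K]
    [AddCommGroup M] [Module k M] (ψ : Module.End k M) (W : Submodule k M)
    (hW : ∀ g : Module.End k M, (∀ m, g (ψ m) = ψ (g m)) → ∀ w ∈ W, g w ∈ W)
    (φ : Module.End K (K ⊗[k] M)) (hφ : ∀ v, φ (ψ.baseChange K v) = ψ.baseChange K (φ v))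
    (v : K ⊗[k] M) (hv : v ∈ W.baseChange K) : φ v ∈ W.baseChange K := by
  rw [Submodule.baseChange_eq_span] at hv
  induction hv using Submodule.span_induction with
  | zero => simp
  | add x y _ _ hx hy => rw [map_add]; exact add_mem hx hy
  | smul a x _ hx => rw [map_smul]; exact Submodule.smul_mem _ a hx
  | mem x hx =>
    obtain ⟨w, hw, rfl⟩ := hx
    refine mem_baseChange_of_contractions W _ fun l => ?_
    let g : Module.End k M := (TensorProduct.lid k M).toLinearMap ∘ₗ LinearMap.rTensor M l ∘ₗ
      φ.restrictScalars k ∘ₗ TensorProduct.mk k K M 1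
    have hl : ∀ z : K ⊗[k] M, TensorProduct.lid k M (LinearMap.rTensor M l (ψ.baseChange K z)) =
        ψ (TensorProduct.lid k M (LinearMap.rTensor M l z)) := fun z => by
      induction z with
      | zero => simp
      | tmul a m => simp
      | add y z hy hz => simp only [map_add, hy, hz]
    refine hW g (fun m => ?_) w hw
    have h := hφ (1 ⊗ₜ m)
    rw [LinearMap.baseChange_tmul] at h
    change TensorProduct.lid k M (LinearMap.rTensor M l (φ (1 ⊗ₜ ψ m))) = _
    rw [h, hl]
    rfl

/-- If scalar extensions of `f` and `g` have nonzero eigenvectors with inverse eigenvalues, then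
`f ⊗ g` has a nonzero fixed vector. -/
theorem ker_map_sub_id_ne_bot {k K M N : Type*} [Field k] [Field K] [Algebra k K]
    [AddCommGroup M] [Module k M] [AddCommGroup N] [Module k N]
    (f : Module.End k M) (g : Module.End k N) (μ ν : K) (hμν : μ * ν = 1)
    (v : K ⊗[k] M) (hv : v ≠ 0) (hfv : f.baseChange K v = μ • v)
    (w : K ⊗[k] N) (hw : w ≠ 0) (hgw : g.baseChange K w = ν • w) :
    LinearMap.ker (TensorProduct.map f g - LinearMap.id) ≠ ⊥ := by
  intro hbot
  let e := TensorProduct.AlgebraTensorModule.distribBaseChange k K M N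
  have hnat : ∀ z, e ((TensorProduct.map f g).baseChange K z) =
      TensorProduct.map (f.baseChange K) (g.baseChange K) (e z) := by
    intro z
    induction z with
    | zero => simp
    | add y z hy hz => simp only [map_add, hy, hz]
    | tmul a x =>
      induction x with
      | zero => simp
      | add y z hy hz => simp only [map_add, tmul_add, hy, hz]
      | tmul m n => simp [e]
  have hinj : Function.Injective (LinearMap.lTensor K (TensorProduct.map f g - LinearMap.id)) :=
    Module.Flat.lTensor_preserves_injective_linearMap _ (LinearMap.ker_eq_bot.mp hbot)
  have hz : e.symm (v ⊗ₜ w) = 0 := by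
    apply hinj
    rw [LinearMap.lTensor_sub, LinearMap.lTensor_id, map_zero, LinearMap.sub_apply, sub_eq_zero]
    apply e.injective
    refine (hnat _).trans ?_
    rw [e.apply_symm_apply, TensorProduct.map_tmul, hfv, hgw, TensorProduct.smul_tmul_smul, hμν,
      one_smul]
    exact (e.apply_symm_apply _).symm
  rw [e.symm.map_eq_zero_iff] at hz
  refine hv ((Module.forall_dual_apply_eq_zero_iff K v).mp fun l => ?_)
  have hlz : l v • w = 0 := by
    rw [← TensorProduct.lid_tmul, ← LinearMap.rTensor_tmul, hz, map_zero, map_zero]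
  exact (smul_eq_zero.mp hlz).resolve_right hw

theorem statement6
    -- H is a finite-dimensional ℚ-vector space with a weight 2 Hodge structure
    (H : Type*) [AddCommGroup H] [Module ℚ H] [FiniteDimensional ℚ H]
    (H20 H11 H02 : Submodule ℂ (ℂ ⊗[ℚ] H))
    (hdec : DirectSum.IsInternal (![H20, H11, H02] : Fin 3 → Submodule ℂ (ℂ ⊗[ℚ] H)))
    (hconj20 : (H20.restrictScalars ℚ).map (conjC H) = H02.restrictScalars ℚ)
    (hconj11 : (H11.restrictScalars ℚ).map (conjC H) = H11.restrictScalars ℚ)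
    -- H^{2,0} ≠ 0
    (h20ne : H20 ≠ ⊥)
    -- ψ is an automorphism of the Hodge structure H with ψ^p = id, p > 0
    (p : ℕ) (hp : 0 < p)
    (ψ : Module.End ℚ H) (hψp : ψ ^ p = 1)
    (hψ11 : ∀ v ∈ H11, ψ.baseChange ℂ v ∈ H11)
    (hψ02 : ∀ v ∈ H02, ψ.baseChange ℂ v ∈ H02)
    -- ψ_ℂ acts on H^{2,0} as multiplication by λ, with λ ≠ 1
    (lam : ℂ) (hlam : lam ≠ 1)
    (hψ20 : ∀ v ∈ H20, ψ.baseChange ℂ v = lam • v)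
    -- H₁ is a finite-dimensional ℚ-vector space with a weight 1 Hodge structure
    (H₁ : Type*) [AddCommGroup H₁] [Module ℚ H₁] [FiniteDimensional ℚ H₁]
    (H10 H01 : Submodule ℂ (ℂ ⊗[ℚ] H₁))
    (hdec1 : IsCompl H10 H01)
    (hconj1 : (H10.restrictScalars ℚ).map (conjC H₁) = H01.restrictScalars ℚ)
    -- ψ' is an automorphism of the Hodge structure H₁ with ψ'^p = id
    (ψ' : Module.End ℚ H₁) (hψ'p : ψ' ^ p = 1)
    (hψ'10 : ∀ v ∈ H10, ψ'.baseChange ℂ v ∈ H10)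
    (hψ'01 : ∀ v ∈ H01, ψ'.baseChange ℂ v ∈ H01)
    -- λ⁻¹ is not an eigenvalue of ψ'_ℂ on H₁^{1,0}
    (hno : ∀ v ∈ H10, ψ'.baseChange ℂ v = lam⁻¹ • v → v = 0)
    -- λ⁻¹ is an eigenvalue of ψ'_ℂ on H₁^{0,1}
    (hyes : ∃ v ∈ H01, v ≠ 0 ∧ ψ'.baseChange ℂ v = lam⁻¹ • v) :
    -- H₂ := the fixed subspace of ψ' ⊗ ψ on H₁ ⊗ H
    ∀ H₂ : Submodule ℚ (H₁ ⊗[ℚ] H),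
      H₂ = LinearMap.ker (TensorProduct.map (ψ' : H₁ →ₗ[ℚ] H₁) (ψ : H →ₗ[ℚ] H)
        - LinearMap.id) →
    -- c : H₁^∨ ⊗ H₂ → H is the contraction map, c(u ⊗ x) = (u ⊗ id_H)(x)
    ∀ c : (Module.Dual ℚ H₁) ⊗[ℚ] H₂ →ₗ[ℚ] H,
      (∀ (u : Module.Dual ℚ H₁) (x : H₂),
        c (u ⊗ₜ x) = TensorProduct.lid ℚ H
          (TensorProduct.map u (LinearMap.id : H →ₗ[ℚ] H) (x : H₁ ⊗[ℚ] H))) →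
    -- the image of c is a nonzero sub-Hodge structure of H
    LinearMap.range c ≠ ⊥ ∧ IsSubHS2 H20 H11 H02 (LinearMap.range c) ∧
    -- in particular, if H is simple then c is surjective
    ((∀ W : Submodule ℚ H, IsSubHS2 H20 H11 H02 W → W = ⊥ ∨ W = ⊤) →
      Function.Surjective c) := by
  intro H₂ hH₂ c hc
  have hfix : ∀ x, x ∈ H₂ ↔ TensorProduct.map ψ' ψ x = x := fun x => by
    rw [hH₂, LinearMap.mem_ker, LinearMap.sub_apply, sub_eq_zero, LinearMap.id_apply]
  have hstable : ∀ g : Module.End ℚ H, (∀ m, g (ψ m) = ψ (g m)) →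
      ∀ w ∈ LinearMap.range c, g w ∈ LinearMap.range c := by
    rintro g hg _ ⟨t, rfl⟩
    induction t with
    | zero => simp
    | add y z hy hz => simp only [map_add]; exact add_mem hy hz
    | tmul u x =>
      have hx : LinearMap.lTensor H₁ g x ∈ H₂ := by
        rw [hfix]
        conv_rhs => rw [← (hfix _).mp x.2]
        have hgψ : g ∘ₗ ψ = ψ ∘ₗ g := LinearMap.ext hg
        rw [LinearMap.lTensor, ← LinearMap.comp_apply, ← LinearMap.comp_apply,
          ← TensorProduct.map_comp, ← TensorProduct.map_comp, hgψ, LinearMap.comp_id,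
          LinearMap.id_comp]
      refine ⟨u ⊗ₜ ⟨_, hx⟩, ?_⟩
      rw [hc, hc, Subtype.coe_mk]
      clear hx
      generalize (x : H₁ ⊗[ℚ] H) = y
      induction y with
      | zero => simp
      | tmul a b => simp
      | add y z hy hz => simp only [map_add, hy, hz]
  have hne : LinearMap.range c ≠ ⊥ := by
    intro hbot
    obtain ⟨v, -, hv0, hv⟩ := hyes
    obtain ⟨w, hw, hw0⟩ := H20.ne_bot_iff.mp h20ne
    have hlam0 : lam ≠ 0 := by
      rintro rfl
      have hpow : (ψ.baseChange ℂ) ^ p = 1 := by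
        rw [← LinearMap.baseChange_pow, hψp, LinearMap.baseChange_one]
      obtain ⟨q, rfl⟩ := Nat.exists_eq_succ_of_ne_zero hp.ne'
      have h := LinearMap.congr_fun hpow w
      rw [pow_succ, Module.End.mul_apply, hψ20 w hw, zero_smul, map_zero] at h
      exact hw0 h.symm
    refine ker_map_sub_id_ne_bot ψ' ψ lam⁻¹ lam (inv_mul_cancel₀ hlam0) v hv0 hv w hw0
      (hψ20 w hw) ?_
    rw [← hH₂, Submodule.eq_bot_iff]
    intro x hx
    obtain ⟨y, rfl⟩ := mem_range_lTensor_subtype_of_contractions (⊥ : Submodule ℚ H) x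
      fun l => by
        rw [← hbot]
        exact ⟨l ⊗ₜ ⟨x, hx⟩, hc l ⟨x, hx⟩⟩
    rw [Subsingleton.elim y 0, map_zero]
  have hsub : IsSubHS2 H20 H11 H02 (LinearMap.range c) := by
    obtain ⟨φ, hmem, hsum, hcomm⟩ := exists_projections_of_isInternal _ hdec
    have hψA : ∀ i, ∀ v ∈ (![H20, H11, H02] : Fin 3 → Submodule ℂ (ℂ ⊗[ℚ] H)) i,
        ψ.baseChange ℂ v ∈ (![H20, H11, H02] : Fin 3 → Submodule ℂ (ℂ ⊗[ℚ] H)) i := by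
      intro i
      fin_cases i
      · intro v hv
        rw [hψ20 v hv]
        exact Submodule.smul_mem _ _ hv
      · exact hψ11
      · exact hψ02
    have hφ : ∀ j, ∀ v ∈ (LinearMap.range c).baseChange ℂ,
        φ j v ∈ (LinearMap.range c).baseChange ℂ := fun j =>
      baseChange_stable_of_commuting ψ _ hstable (φ j) (hcomm _ hψA j)
    refine le_antisymm (fun v hv => ?_)
      (sup_le (sup_le inf_le_left inf_le_left) inf_le_left)
    rw [← hsum v, Fin.sum_univ_three]
    exact Submodule.add_mem_sup
      (Submodule.add_mem_sup ⟨hφ 0 v hv, hmem 0 v⟩ ⟨hφ 1 v hv, hmem 1 v⟩) ⟨hφ 2 v hv, hmem 2 v⟩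
  exact ⟨hne, hsub, fun hsimple =>
    LinearMap.range_eq_top.mp ((hsimple _ hsub).resolve_left hne)⟩
end

section
/- Let n ≥ 5, let V be an n-dimensional complex vector space, and let B be a nondegenerate symmetric ℂ-bilinear form on V. Let 𝔰𝔬(B) := {f ∈ End_ℂ(V) : B(f x, y) + B(x, f y) = 0 for all x, y ∈ V}. Then every ℂ-linear map φ : V → V ⊗_ℂ V satisfying φ(f x) = (f ⊗ id_V + id_V ⊗ f)(φ(x)) for all f ∈ 𝔰𝔬(B) and all x ∈ V is the zero map. -/
/- STATEMENT 7: For n ≥ 5 and a nondegenerate symmetric bilinear form B on an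
n-dimensional complex vector space V, every 𝔰𝔬(B)-equivariant linear map
φ : V → V ⊗ V is zero. -/

open TensorProduct

section

variable {K V : Type*} [Field K] [AddCommGroup V] [Module K V]

/-- The trilinear form `(x, y, z) ↦ (B y ⊗ B z) (φ x)` attached to `φ : V → V ⊗ V`. -/
noncomputable def contractedForm (B : LinearMap.BilinForm K V) (φ : V →ₗ[K] V ⊗[K] V)
    (x y z : V) : K :=
  LinearMap.mul' K K (TensorProduct.map (B y) (B z) (φ x))

/-- The endomorphism `v ↦ B u v • w - B w v • u`. -/
noncomputable def planeRotation (B : LinearMap.BilinForm K V) (u w : V) : Module.End K V :=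
  (B u).smulRight w - (B w).smulRight u

lemma planeRotation_apply (B : LinearMap.BilinForm K V) (u w v : V) :
    planeRotation B u w v = B u v • w - B w v • u := rfl

lemma planeRotation_skew (B : LinearMap.BilinForm K V) (hsymm : ∀ x y, B x y = B y x)
    (u w x y : V) : B (planeRotation B u w x) y + B x (planeRotation B u w y) = 0 := by
  simp only [planeRotation_apply, map_sub, map_smul, LinearMap.sub_apply, LinearMap.smul_apply,
    smul_eq_mul, hsymm x]
  ring

lemma contractedForm_invariant (B : LinearMap.BilinForm K V) (φ : V →ₗ[K] V ⊗[K] V)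
    (f : Module.End K V) (hf : ∀ x y : V, B (f x) y + B x (f y) = 0)
    (hφ : ∀ x : V, φ (f x) =
      (TensorProduct.map f (LinearMap.id : V →ₗ[K] V)
        + TensorProduct.map (LinearMap.id : V →ₗ[K] V) f) (φ x)) (x y z : V) :
    contractedForm B φ (f x) y z + contractedForm B φ x (f y) z
      + contractedForm B φ x y (f z) = 0 := by
  have key (t : V ⊗[K] V) :
      LinearMap.mul' K K (TensorProduct.map (B y) (B z)
        ((TensorProduct.map f (LinearMap.id : V →ₗ[K] V)
          + TensorProduct.map (LinearMap.id : V →ₗ[K] V) f) t))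
        + LinearMap.mul' K K (TensorProduct.map (B (f y)) (B z) t)
        + LinearMap.mul' K K (TensorProduct.map (B y) (B (f z)) t) = 0 := by
    induction t using TensorProduct.induction_on with
    | zero => simp
    | tmul p q =>
      simp only [LinearMap.add_apply, TensorProduct.map_tmul, map_add, LinearMap.id_apply,
        LinearMap.mul'_apply]
      linear_combination B z q * hf y p + B y p * hf z q
    | add s t hs ht =>
      simp only [map_add] at hs ht ⊢
      linear_combination hs + ht
  simpa only [contractedForm, hφ] using key (φ x)

variable {ι : Type*} (b : Module.Basis ι K V) {B : LinearMap.BilinForm K V}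

lemma contractedForm_basis (hb : B.IsOrthoᵢ b) (φ : V →ₗ[K] V ⊗[K] V) (x : V) (j k : ι) :
    contractedForm B φ x (b j) (b k) =
      B (b j) (b j) * B (b k) (b k) * (b.tensorProduct b).repr (φ x) (j, k) := by
  have hB (j : ι) (v : V) : B (b j) v = B (b j) (b j) * b.repr v j := by
    suffices B (b j) = B (b j) (b j) • b.coord j from LinearMap.congr_fun this v
    refine b.ext fun i => ?_
    by_cases h : i = j
    · subst h; simp
    · simpa [Finsupp.single_apply, h] using hb (Ne.symm h)
  unfold contractedForm
  induction φ x using TensorProduct.induction_on with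
  | zero => simp
  | tmul p q =>
    simp only [TensorProduct.map_tmul, LinearMap.mul'_apply, hB j p, hB k q,
      Module.Basis.tensorProduct_repr_tmul_apply, smul_eq_mul]
    ring
  | add s t hs ht => simp only [map_add, Finsupp.add_apply, hs, ht]; ring

/-- If the contracted form vanishes on an orthogonal basis, so does the map it comes from. -/
lemma eq_zero_of_contractedForm_basis_eq_zero (hb : B.IsOrthoᵢ b)
    (hb0 : ∀ i, B (b i) (b i) ≠ 0) (φ : V →ₗ[K] V ⊗[K] V)
    (h : ∀ i j k, contractedForm B φ (b i) (b j) (b k) = 0) : φ = 0 := by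
  refine b.ext fun i => (b.tensorProduct b).ext_elem fun ⟨j, k⟩ => ?_
  simpa [contractedForm_basis b hb, hb0] using h i j k

lemma contractedForm_basis_eq_zero [Fintype ι] (hι : 4 ≤ Fintype.card ι)
    (hsymm : ∀ x y, B x y = B y x) (hb : B.IsOrthoᵢ b)
    (hb0 : ∀ i, B (b i) (b i) ≠ 0) (φ : V →ₗ[K] V ⊗[K] V)
    (hequiv : ∀ f : Module.End K V,
      (∀ x y : V, B (f x) y + B x (f y) = 0) →
      ∀ x : V, φ (f x) =
        (TensorProduct.map f (LinearMap.id : V →ₗ[K] V)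
          + TensorProduct.map (LinearMap.id : V →ₗ[K] V) f) (φ x)) (i j k : ι) :
    contractedForm B φ (b i) (b j) (b k) = 0 := by
  classical
  have hinv (d a : ι) (x y z : V) :=
    contractedForm_invariant B φ _ (planeRotation_skew B hsymm (b d) (b a))
      (hequiv _ (planeRotation_skew B hsymm (b d) (b a))) x y z
  have ortho {p q : ι} (h : p ≠ q) : B (b p) (b q) = 0 := hb h
  have rot_fst {d a : ι} (h : d ≠ a) :
      planeRotation B (b d) (b a) (b d) = B (b d) (b d) • b a := by
    simp [planeRotation_apply, ortho h.symm]
  have rot_snd {d a : ι} (h : d ≠ a) :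
      planeRotation B (b d) (b a) (b a) = (-B (b a) (b a)) • b d := by
    simp [planeRotation_apply, ortho h]
  have rot_other {d a c : ι} (h : d ≠ c) (h' : a ≠ c) :
      planeRotation B (b d) (b a) (b c) = 0 := by
    simp [planeRotation_apply, ortho h, ortho h']
  have zero₂ (x z : V) : contractedForm B φ x 0 z = 0 := by simp [contractedForm]
  have zero₃ (x y : V) : contractedForm B φ x y 0 = 0 := by simp [contractedForm]
  have zero₁ (y z : V) : contractedForm B φ 0 y z = 0 := by simp [contractedForm]
  have smul₁ (c : K) (x y z : V) :
      contractedForm B φ (c • x) y z = c * contractedForm B φ x y z := by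
    simp [contractedForm]
  have smul₂ (c : K) (x y z : V) :
      contractedForm B φ x (c • y) z = c * contractedForm B φ x y z := by
    simp [contractedForm, TensorProduct.map_smul_left]
  have smul₃ (c : K) (x y z : V) :
      contractedForm B φ x y (c • z) = c * contractedForm B φ x y z := by
    simp [contractedForm, TensorProduct.map_smul_right]
  have fresh (i j k : ι) : ∃ d, d ≠ i ∧ d ≠ j ∧ d ≠ k := by
    obtain ⟨d, hd⟩ := Finset.exists_mem_notMem_of_card_lt_card
      (s := ({i, j, k} : Finset ι)) (t := Finset.univ)
      (lt_of_le_of_lt Finset.card_le_three (by rw [Finset.card_univ]; omega))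
    exact ⟨d, by simpa using hd⟩
  have once₁ {i j k : ι} (hj : i ≠ j) (hk : i ≠ k) :
      contractedForm B φ (b i) (b j) (b k) = 0 := by
    obtain ⟨d, hi', hj', hk'⟩ := fresh i j k
    simpa [rot_fst hi', rot_other hj' hj, rot_other hk' hk, zero₂, zero₃, smul₁, hb0]
      using hinv d i (b d) (b j) (b k)
  have once₂ {i j k : ι} (hi : j ≠ i) (hk : j ≠ k) :
      contractedForm B φ (b i) (b j) (b k) = 0 := by
    obtain ⟨d, hi', hj', hk'⟩ := fresh i j k
    simpa [rot_fst hj', rot_other hi' hi, rot_other hk' hk, zero₁, zero₃, smul₂, hb0]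
      using hinv d j (b i) (b d) (b k)
  have once₃ {i j k : ι} (hi : k ≠ i) (hj : k ≠ j) :
      contractedForm B φ (b i) (b j) (b k) = 0 := by
    obtain ⟨d, hi', hj', hk'⟩ := fresh i j k
    simpa [rot_fst hk', rot_other hi' hi, rot_other hj' hj, zero₁, zero₂, smul₃, hb0]
      using hinv d k (b i) (b j) (b d)
  have diag (i : ι) : contractedForm B φ (b i) (b i) (b i) = 0 := by
    obtain ⟨d, hd, -, -⟩ := fresh i i i
    simpa [rot_fst hd, rot_snd hd, -neg_smul, smul₁, smul₂, smul₃, hb0,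
      once₃ hd.symm hd.symm, once₂ hd.symm hd.symm] using hinv d i (b d) (b i) (b i)
  by_cases hij : i = j
  · subst hij
    by_cases hik : i = k
    · subst hik
      exact diag i
    · exact once₃ (Ne.symm hik) (Ne.symm hik)
  · by_cases hik : i = k
    · subst hik
      exact once₂ (Ne.symm hij) (Ne.symm hij)
    · exact once₁ hij hik

end

theorem statement7
    (n : ℕ) (hn : 5 ≤ n)
    (V : Type*) [AddCommGroup V] [Module ℂ V] [FiniteDimensional ℂ V]
    (hdim : Module.finrank ℂ V = n)
    (B : LinearMap.BilinForm ℂ V)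
    (hsymm : ∀ x y, B x y = B y x)
    (hnd : B.Nondegenerate)
    (φ : V →ₗ[ℂ] V ⊗[ℂ] V)
    -- φ is equivariant for every f ∈ 𝔰𝔬(B), acting on V ⊗ V by f ⊗ id + id ⊗ f
    (hequiv : ∀ f : Module.End ℂ V,
      (∀ x y : V, B (f x) y + B x (f y) = 0) →
      ∀ x : V, φ (f x) =
        (TensorProduct.map f (LinearMap.id : V →ₗ[ℂ] V)
          + TensorProduct.map (LinearMap.id : V →ₗ[ℂ] V) f) (φ x)) :
    φ = 0 := by
  obtain ⟨b, hb⟩ := LinearMap.BilinForm.exists_orthogonal_basis (B := B) ⟨hsymm⟩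
  have hb0 (i) : B (b i) (b i) ≠ 0 :=
    hb.not_isOrtho_basis_self_of_separatingLeft hnd.1 i
  exact eq_zero_of_contractedForm_basis_eq_zero b hb hb0 φ
    (contractedForm_basis_eq_zero b (by rw [Fintype.card_fin]; omega) hsymm hb hb0 φ hequiv)
end
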